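/- For every n ∈ ℤ and every x ∈ [2n+1, 2n+2], p'(x) = n + 1; that is, p' is constant equal to n+1 on each odd interval [2n+1, 2n+2]. -/

import Mathlib

noncomputable def parity (x : ℝ) : ℝ := max 0 (Real.pi / 2 * Real.sin (Real.pi * x))

noncomputable def pfun (x : ℝ) : ℝ := ∫ t in (0:ℝ)..(x - 1), parity t

noncomputable def pfun' (x : ℝ) : ℝ := pfun (x - 1) + 1

theorem continuous_parity : Continuous parity := by
  unfold parity
  fun_prop

theorem parity_intervalIntegrable (a b : ℝ) :
    IntervalIntegrable parity MeasureTheory.volume a b :=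
  continuous_parity.intervalIntegrable a b

theorem parity_periodic : Function.Periodic parity 2 := by
  intro x
  have h : Real.pi * (x + 2) = Real.pi * x + 2 * Real.pi := by ring
  simp only [parity, h, Real.sin_add_two_pi]

theorem parity_eq_zero_of_mem_Icc (n : ℤ) {t : ℝ} (ht : t ∈ Set.Icc (2 * n - 1 : ℝ) (2 * n)) :
    parity t = 0 := by
  have hpi := Real.pi_pos
  have hsin : Real.sin (Real.pi * t) ≤ 0 := by
    rw [← Real.sin_sub_int_mul_two_pi _ n]
    apply Real.sin_nonpos_of_nonpos_of_neg_pi_le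
    · nlinarith [ht.2]
    · nlinarith [ht.1]
  exact max_eq_left (mul_nonpos_of_nonneg_of_nonpos (by positivity) hsin)

theorem parity_eq_of_mem_Icc {t : ℝ} (ht : t ∈ Set.Icc (0 : ℝ) 1) :
    parity t = Real.pi / 2 * Real.sin (Real.pi * t) := by
  have hpi := Real.pi_pos
  have hsin : 0 ≤ Real.sin (Real.pi * t) :=
    Real.sin_nonneg_of_nonneg_of_le_pi (mul_nonneg hpi.le ht.1) (by nlinarith [ht.2])
  exact max_eq_right (by positivity)

theorem integral_parity_zero_one : ∫ t in (0 : ℝ)..1, parity t = 1 := by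
  have hpi := Real.pi_ne_zero
  rw [intervalIntegral.integral_congr (g := fun t => Real.pi / 2 * Real.sin (Real.pi * t))
    fun t ht => parity_eq_of_mem_Icc (by rwa [Set.uIcc_of_le zero_le_one] at ht)]
  rw [intervalIntegral.integral_const_mul,
    intervalIntegral.integral_comp_mul_left (fun t => Real.sin t) hpi]
  simp only [mul_zero, mul_one, integral_sin, Real.cos_zero, Real.cos_pi, smul_eq_mul]
  field_simp
  norm_num

theorem integral_parity_eq_zero (n : ℤ) {y : ℝ} (hy : y ∈ Set.Icc (2 * n - 1 : ℝ) (2 * n)) :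
    ∫ t in y..(2 * n : ℝ), parity t = 0 := by
  rw [intervalIntegral.integral_congr (g := fun _ => (0 : ℝ)) fun t ht => ?_,
    intervalIntegral.integral_zero]
  rw [Set.uIcc_of_le hy.2] at ht
  exact parity_eq_zero_of_mem_Icc n ⟨hy.1.trans ht.1, ht.2⟩

theorem integral_parity_zero_two : ∫ t in (0 : ℝ)..2, parity t = 1 := by
  have h := integral_parity_eq_zero 1 (y := 1) (by norm_num)
  norm_num at h
  rw [← intervalIntegral.integral_add_adjacent_intervals (parity_intervalIntegrable 0 1)
    (parity_intervalIntegrable 1 2), integral_parity_zero_one, h, add_zero]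

theorem integral_parity_zero_two_mul (n : ℤ) : ∫ t in (0 : ℝ)..(2 * n), parity t = n := by
  have h := parity_periodic.intervalIntegral_add_zsmul_eq n 0 parity_intervalIntegrable
  simpa [integral_parity_zero_two, mul_comm] using h

theorem pfun'_eq_on_odd_interval (n : ℤ) :
    ∀ x ∈ Set.Icc ((2*n + 1 : ℝ)) (2*n + 2), pfun' x = n + 1 := by
  intro x hx
  have hzero := integral_parity_eq_zero n (y := x - 1 - 1)
    ⟨by linarith [hx.1], by linarith [hx.2]⟩
  have hadd := intervalIntegral.integral_add_adjacent_intervals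
    (parity_intervalIntegrable 0 (x - 1 - 1)) (parity_intervalIntegrable (x - 1 - 1) (2 * n))
  rw [hzero, integral_parity_zero_two_mul, add_zero] at hadd
  rw [pfun', pfun, hadd]
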